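/- arXiv:1702.01309 — 2 statements merged into one kernel-verified Lean document; each statement's English description precedes it below -/
import Mathlib

section
/- Suppose q^{m/2} ≡ −1 (mod N). Let m/2 ≤ l ≤ m and let L be any F_q-subspace of F_Q with dim_{F_q} L = l such that F_{q^{m/2}} ⊆ L. Then |L ∩ C_0^{(N)}| = (q^l − 1)/N + (N−1)(q^{m/2} − q^{l−m/2})/N; that is, such an L achieves the maximal possible intersection with C_0^{(N)} among l-dimensional F_q-subspaces. -/
section

open Finset

/-- In a field with an involutive endomorphism `σ`, every non-fixed `x` factors uniquely as `u * y`
with `u` fixed and `σ y - y` equal to a prescribed nonzero value `σ a - a`. -/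
theorem card_rootsOfUnity_not_fixed {F : Type*} [Field F] [Fintype F] [DecidableEq F]
    (σ : F →+* F) (hσ : ∀ x, σ (σ x) = x) (r : ℕ)
    (hfix : ∀ u, u ≠ 0 → σ u = u → u ^ r = 1) {a : F} (ha : σ a ≠ a) :
    #{x : F | x ^ r = 1 ∧ σ x ≠ x} =
      #{u : F | u ≠ 0 ∧ σ u = u} * #{x : F | x ^ r = 1 ∧ σ x - x = σ a - a} := by
  have hd : σ a - a ≠ 0 := sub_ne_zero.2 ha
  have hd' : a - σ a ≠ 0 := sub_ne_zero.2 (Ne.symm ha)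
  have key : ∀ x, σ x ≠ x → (σ x - x) / (σ a - a) ≠ 0 ∧
      σ ((σ x - x) / (σ a - a)) = (σ x - x) / (σ a - a) := by
    intro x hx
    refine ⟨div_ne_zero (sub_ne_zero.2 hx) hd, ?_⟩
    simp only [map_div₀, map_sub, hσ]
    rw [div_eq_div_iff hd' hd]
    ring
  rw [← card_product]
  symm
  refine card_nbij' (fun p => p.1 * p.2)
    (fun x => ((σ x - x) / (σ a - a), x / ((σ x - x) / (σ a - a)))) ?_ ?_ ?_ ?_
  · rintro ⟨u, y⟩ h
    simp only [coe_product, coe_filter, mem_univ, true_and, Set.mem_prod, Set.mem_ofPred_eq] at h ⊢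
    obtain ⟨⟨hu, hσu⟩, hy, hya⟩ := h
    refine ⟨by rw [mul_pow, hfix u hu hσu, hy, one_mul], ?_⟩
    rw [map_mul, hσu]
    intro h
    exact hd (by rw [← hya, mul_left_cancel₀ hu h, sub_self])
  · intro x h
    simp only [coe_product, coe_filter, mem_univ, true_and, Set.mem_prod, Set.mem_ofPred_eq] at h ⊢
    obtain ⟨hx, hxσ⟩ := h
    obtain ⟨hu, hσu⟩ := key x hxσ
    refine ⟨⟨hu, hσu⟩, by rw [div_pow, hfix _ hu hσu, hx, div_one], ?_⟩
    rw [map_div₀, hσu, ← sub_div, div_div_cancel₀ (sub_ne_zero.2 hxσ)]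
  · rintro ⟨u, y⟩ h
    simp only [coe_product, coe_filter, mem_univ, true_and, Set.mem_prod, Set.mem_ofPred_eq] at h
    obtain ⟨⟨hu, hσu⟩, -, hya⟩ := h
    have hu' : (σ (u * y) - u * y) / (σ a - a) = u := by
      rw [map_mul, hσu, ← mul_sub, hya, mul_div_cancel_right₀ _ hd]
    simp only [hu', mul_div_cancel_left₀ y hu]
  · intro x h
    simp only [coe_filter, mem_univ, true_and, Set.mem_ofPred_eq] at h
    exact mul_div_cancel₀ x (key x h.2).1

/-- Double counting of the pairs of non-fixed elements lying in a common coset of the fixed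
points of `σ`. -/
theorem card_fixed_mul_card_not_fixed {F : Type*} [Ring F] [Fintype F] [DecidableEq F]
    (σ : F →+* F) (L : AddSubgroup F) [DecidablePred (· ∈ L)] (hL : ∀ x, σ x = x → x ∈ L)
    (P : F → Prop) [DecidablePred P] (c : ℕ)
    (hc : ∀ b, σ b ≠ b → #{x : F | P x ∧ σ x - x = σ b - b} = c) :
    #{x : F | x ∈ L ∧ P x ∧ σ x ≠ x} * #{x : F | σ x = x} =
      #{x : F | x ∈ L ∧ σ x ≠ x} * c := by
  have hmem : ∀ x b, σ x - x = σ b - b → b ∈ L → x ∈ L := by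
    intro x b h hb
    have : x - b ∈ L := hL _ (by rw [map_sub]; rw [← sub_eq_zero] at h ⊢; rw [← h]; abel)
    simpa using L.add_mem this hb
  refine card_mul_eq_card_mul (fun x b => σ x - x = σ b - b) ?_ ?_
  · intro x hx
    simp only [mem_filter, mem_univ, true_and] at hx
    refine card_nbij' (fun b => b - x) (fun e => x + e) ?_ ?_ ?_ ?_
    · intro b hb
      simp only [coe_bipartiteAbove, coe_filter, mem_filter, mem_univ, true_and,
        Set.mem_ofPred_eq, map_sub] at hb ⊢
      have h := hb.2
      rw [← sub_eq_zero] at h ⊢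
      rw [← neg_eq_zero, ← h]
      abel
    · intro e he
      simp only [coe_bipartiteAbove, coe_filter, mem_filter, mem_univ, true_and,
        Set.mem_ofPred_eq, map_add] at he ⊢
      refine ⟨⟨L.add_mem hx.1 (hL e he), ?_⟩, ?_⟩
      · simpa [he] using hx.2.2
      · rw [he]; abel
    · intro b _; simp
    · intro e _; simp
  · intro b hb
    simp only [mem_filter, mem_univ, true_and] at hb
    rw [← hc b hb.2]
    congr 1
    ext x
    simp only [mem_bipartiteBelow, mem_filter, mem_univ, true_and]
    constructor
    · rintro ⟨⟨-, hP, -⟩, h⟩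
      exact ⟨hP, h⟩
    · rintro ⟨hP, h⟩
      refine ⟨⟨hmem x b h hb.1, hP, ?_⟩, h⟩
      rw [← sub_ne_zero, h, sub_ne_zero]
      exact hb.2

theorem ne_zero_of_forall_exists_pow {F : Type*} [Field F] [Fintype F] {γ : F}
    (hγ : ∀ x : F, x ≠ 0 → ∃ k : ℕ, x = γ ^ k) (hF : 2 < Fintype.card F) : γ ≠ 0 := by
  classical
  rintro rfl
  have hsub : (univ : Finset F) ⊆ {0, 1} := by
    intro x _
    by_cases hx : x = 0
    · simp [hx]
    · obtain ⟨k, hk⟩ := hγ x hx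
      rcases Nat.eq_zero_or_pos k with rfl | hk0
      · simp [hk]
      · exact absurd (hk.trans (zero_pow hk0.ne')) hx
  have h1 := (card_le_card hsub).trans card_le_two
  rw [card_univ] at h1
  omega

theorem orderOf_eq_card_sub_one {F : Type*} [Field F] [Fintype F] {γ : F}
    (hγ : ∀ x : F, x ≠ 0 → ∃ k : ℕ, x = γ ^ k) (hγ0 : γ ≠ 0) :
    orderOf γ = Fintype.card F - 1 := by
  classical
  lift γ to Fˣ using hγ0.isUnit
  rw [orderOf_units, ← Fintype.card_units, ← Nat.card_eq_fintype_card]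
  refine orderOf_eq_card_of_forall_mem_zpowers fun x => ?_
  obtain ⟨k, hk⟩ := hγ x x.ne_zero
  exact ⟨k, Units.ext (by simp [hk])⟩

theorem exists_eq_pow_pow_iff {F : Type*} [Field F] {γ : F}
    (hγ : ∀ x : F, x ≠ 0 → ∃ k : ℕ, x = γ ^ k) {M r : ℕ} (hr : 0 < r)
    (hord : orderOf γ = M * r) (x : F) : (∃ k : ℕ, x = (γ ^ M) ^ k) ↔ x ^ r = 1 := by
  constructor
  · rintro ⟨k, rfl⟩
    rw [pow_right_comm, ← pow_mul γ, ← hord, pow_orderOf_eq_one, one_pow]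
  · intro hx
    have hx0 : x ≠ 0 := by
      rintro rfl
      rw [zero_pow hr.ne'] at hx
      exact zero_ne_one hx
    obtain ⟨k, rfl⟩ := hγ x hx0
    rw [← pow_mul, ← orderOf_dvd_iff_pow_eq_one, hord] at hx
    obtain ⟨j, rfl⟩ := Nat.dvd_of_mul_dvd_mul_right hr hx
    exact ⟨j, pow_mul _ _ _⟩

theorem card_pow_eq_one_of_orderOf {F : Type*} [Field F] [Fintype F] [DecidableEq F] {γ : F}
    {M r : ℕ} (hM : 0 < M) (hr : 0 < r)
    (hord : orderOf γ = M * r) : #{x : F | x ^ r = 1} = r := by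
  have h : orderOf (γ ^ M) = r := by
    rw [orderOf_pow_of_dvd hM.ne' (hord ▸ dvd_mul_right M r), hord, Nat.mul_div_cancel_left _ hM]
  have hprim := IsPrimitiveRoot.orderOf (γ ^ M)
  rw [h] at hprim
  refine Eq.trans ?_ hprim.card_nthRootsFinset
  congr 1
  ext x
  simp [Polynomial.mem_nthRootsFinset hr]

/-- The intersection count for a field with `s ^ 2` elements, where `σ` is the involution
`x ↦ x ^ s` and `N * d = s + 1`. -/
theorem card_inter_rootsOfUnity {F : Type*} [Field F] [Fintype F] [DecidableEq F]
    {γ : F} (hγ : ∀ x : F, x ≠ 0 → ∃ k : ℕ, x = γ ^ k) {s N d t : ℕ} (hs : 2 ≤ s)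
    (hF : Fintype.card F = s * s) (hd : s + 1 = N * d) (σ : F →+* F) (hσ : ∀ x, σ x = x ^ s)
    (L : AddSubgroup F) [DecidablePred (· ∈ L)] (hL : ∀ x, σ x = x → x ∈ L)
    (hLcard : #{x : F | x ∈ L} = s * t) :
    (#{x : F | x ∈ L ∧ x ^ (d * (s - 1)) = 1} : ℚ) = s - 1 + (t - 1) * (d - 1) := by
  obtain ⟨v, rfl⟩ : ∃ v, s = v + 1 := ⟨s - 1, by omega⟩
  simp only [Nat.add_sub_cancel] at *
  have hv : 0 < v := by omega
  have hN : 0 < N := Nat.pos_of_ne_zero (by rintro rfl; omega)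
  have hd0 : 0 < d := Nat.pos_of_ne_zero (by rintro rfl; omega)
  have hγ0 : γ ≠ 0 := ne_zero_of_forall_exists_pow hγ (by rw [hF]; nlinarith)
  have hord : orderOf γ = (v + 1 + 1) * v := by
    rw [orderOf_eq_card_sub_one hγ hγ0, hF]
    have : (v + 1) * (v + 1) = (v + 1 + 1) * v + 1 := by ring
    omega
  have hord' : orderOf γ = N * (d * v) := by rw [hord, hd, mul_assoc]
  have hσσ : ∀ x, σ (σ x) = x := fun x => by
    rw [hσ, hσ, ← pow_mul, ← hF, FiniteField.pow_card]
  have hfix : ∀ u, u ≠ 0 → (σ u = u ↔ u ^ v = 1) := fun u hu => by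
    rw [hσ, pow_succ]
    exact mul_eq_right₀ hu
  have hfixC : ∀ u, u ≠ 0 → σ u = u → u ^ (d * v) = 1 := fun u hu h => by
    rw [mul_comm, pow_mul, (hfix u hu).1 h, one_pow]
  have cardC : #{x : F | x ^ (d * v) = 1} = d * v :=
    card_pow_eq_one_of_orderOf hN (by positivity) hord'
  have cardE' : #{u : F | u ≠ 0 ∧ σ u = u} = v := by
    rw [← card_pow_eq_one_of_orderOf (by omega) hv hord]
    congr 1
    ext u
    simp only [mem_filter, mem_univ, true_and]
    constructor
    · rintro ⟨hu, h⟩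
      exact (hfix u hu).1 h
    · intro h
      have hu : u ≠ 0 := by
        rintro rfl
        simp [zero_pow hv.ne'] at h
      exact ⟨hu, (hfix u hu).2 h⟩
  have cardE : #{u : F | σ u = u} = v + 1 := by
    have : ({u : F | σ u = u} : Finset F) =
        insert 0 ({u : F | u ≠ 0 ∧ σ u = u} : Finset F) := by
      ext u
      by_cases hu : u = 0 <;> simp [hu]
    rw [this, card_insert_of_notMem (by simp), cardE']
  have hzero : ∀ u : F, u ^ (d * v) = 1 → u ≠ 0 := by
    rintro u hu rfl
    rw [zero_pow (by positivity)] at hu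
    exact zero_ne_one hu
  have hCsplit : d * v = v + #{x : F | x ^ (d * v) = 1 ∧ σ x ≠ x} := by
    conv_lhs => rw [← cardC, ← card_filter_add_card_filter_not (fun x => σ x = x)]
    rw [filter_filter, filter_filter]
    refine congrArg (· + _) (Eq.trans (congrArg card ?_) cardE')
    ext x
    simp only [mem_filter, mem_univ, true_and]
    exact ⟨fun h => ⟨hzero x h.1, h.2⟩, fun h => ⟨hfixC x h.1 h.2, h.2⟩⟩
  have hcoset : ∀ b, σ b ≠ b → #{x : F | x ^ (d * v) = 1 ∧ σ x - x = σ b - b} = d - 1 := by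
    intro b hb
    have h := card_rootsOfUnity_not_fixed σ hσσ (d * v) hfixC hb
    rw [cardE'] at h
    have h2 : v * d = v * (1 + #{x : F | x ^ (d * v) = 1 ∧ σ x - x = σ b - b}) := by
      rw [mul_add, ← h, mul_one, mul_comm v d]
      exact hCsplit
    have := Nat.eq_of_mul_eq_mul_left hv h2
    omega
  have hcount := card_fixed_mul_card_not_fixed σ L hL (fun x => x ^ (d * v) = 1) (d - 1) hcoset
  have hLsplit : (v + 1) * t = (v + 1) + #{x : F | x ∈ L ∧ σ x ≠ x} := by
    rw [← hLcard, ← card_filter_add_card_filter_not (fun x => σ x = x), filter_filter,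
      filter_filter, ← cardE]
    congr 2
    ext x
    simp only [mem_filter, mem_univ, true_and]
    exact ⟨fun h => h.2, fun h => ⟨hL x h, h⟩⟩
  have hLCsplit : #{x : F | x ∈ L ∧ x ^ (d * v) = 1} =
      v + #{x : F | x ∈ L ∧ x ^ (d * v) = 1 ∧ σ x ≠ x} := by
    rw [← card_filter_add_card_filter_not (fun x => σ x = x), filter_filter,
      filter_filter]
    simp only [and_assoc]
    refine congrArg (· + _) (Eq.trans (congrArg card ?_) cardE')
    ext x
    simp only [mem_filter, mem_univ, true_and]
    exact ⟨fun h => ⟨hzero x h.2.1, h.2.2⟩, fun h => ⟨hL x h.2, hfixC x h.1 h.2, h.2⟩⟩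
  rw [hLCsplit]
  rw [cardE] at hcount
  qify [hd0] at hcount hLsplit
  push_cast
  have hv' : (v : ℚ) + 1 ≠ 0 := by positivity
  apply mul_right_cancel₀ hv'
  linear_combination hcount - (d - 1 : ℚ) * hLsplit

end

theorem stmt5 (q m : ℕ) (hq : IsPrimePow q) (hmeven : Even m) (hm : 2 ≤ m)
    (K F : Type) [Field K] [Fintype K] [Field F] [Fintype F] [Algebra K F]
    (hK : Fintype.card K = q) (hF : Fintype.card F = q ^ m)
    (γ : F) (hγ : ∀ x : F, x ≠ 0 → ∃ k : ℕ, x = γ ^ k)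
    (N : ℕ) (hN0 : 0 < N) (hNdvd : N ∣ q ^ m - 1)
    (hsemi : (q : ZMod N) ^ (m / 2) = -1)
    (l : ℕ) (hl1 : m / 2 ≤ l) (hl2 : l ≤ m)
    (L : Submodule K F) (hdim : Module.finrank K L = l)
    (hsub : {x : F | x ^ q ^ (m / 2) = x} ⊆ (L : Set F)) :
    (Set.ncard ((L : Set F) ∩ {x : F | ∃ k : ℕ, x = (γ ^ N) ^ k}) : ℚ) =
      ((q : ℚ) ^ l - 1) / N +
        ((N : ℚ) - 1) * ((q : ℚ) ^ (m / 2) - (q : ℚ) ^ (l - m / 2)) / N := by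
  classical
  obtain ⟨h, rfl⟩ := hmeven
  obtain ⟨t, rfl⟩ : ∃ t, l = h + t := ⟨l - h, by omega⟩
  have hh : (h + h) / 2 = h := by omega
  rw [hh] at hl1 hsemi hsub ⊢
  have hq2 : 2 ≤ q := hq.two_le
  have hs : 2 ≤ q ^ h := hq2.trans (Nat.le_self_pow (by omega) q)
  obtain ⟨d, hd⟩ : N ∣ q ^ h + 1 := by
    rw [← ZMod.natCast_eq_zero_iff]
    push_cast
    rw [hsemi, neg_add_cancel]
  have hF' : Fintype.card F = q ^ h * q ^ h := by rw [hF, pow_add]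
  obtain ⟨p, hp⟩ := CharP.exists K
  have hpF : CharP F p := charP_of_injective_algebraMap (algebraMap K F).injective p
  obtain ⟨n, hpp, hn⟩ := FiniteField.card K p
  have : Fact p.Prime := ⟨hpp⟩
  have hσ : ∀ x : F, iterateFrobenius F p (n * h) x = x ^ q ^ h := fun x => by
    rw [iterateFrobenius_def, pow_mul, ← hn, hK]
  have hLcard : (Finset.univ.filter fun x : F => x ∈ L.toAddSubgroup).card = q ^ h * q ^ t := by
    rw [← pow_add, ← hdim, ← hK, ← Module.card_eq_pow_finrank, Fintype.card_subtype]
    rfl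
  have key := card_inter_rootsOfUnity hγ hs hF' hd _ hσ L.toAddSubgroup
    (fun x hx => hsub (by rwa [hσ] at hx)) hLcard
  have hd0 : 0 < d := Nat.pos_of_ne_zero (by rintro rfl; omega)
  have hord : orderOf γ = N * (d * (q ^ h - 1)) := by
    rw [orderOf_eq_card_sub_one hγ (ne_zero_of_forall_exists_pow hγ (by rw [hF']; nlinarith)), hF',
      ← mul_assoc, ← hd, ← Nat.sq_sub_sq, sq, one_pow]
  have hset : (L : Set F) ∩ {x : F | ∃ k : ℕ, x = (γ ^ N) ^ k} =
      (Finset.univ.filter fun x : F => x ∈ L.toAddSubgroup ∧ x ^ (d * (q ^ h - 1)) = 1) := by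
    ext x
    simp [exists_eq_pow_pow_iff hγ (Nat.mul_pos hd0 (by omega)) hord x]
  rw [hset, Set.ncard_coe_finset, key]
  have hdQ : (q : ℚ) ^ h + 1 = N * d := by exact_mod_cast hd
  have hNQ : (N : ℚ) ≠ 0 := by positivity
  rw [Nat.add_sub_cancel_left, pow_add]
  push_cast
  field_simp
  linear_combination (1 - (q : ℚ) ^ t) * hdQ
end

section
/- Let t ≥ 1 and 1 ≤ r ≤ tm be integers, and write tm − r = r_1·m + r_2 with integers 0 ≤ r_1 ≤ t−1 and 0 ≤ r_2 ≤ m−1. Then the maximum of Σ_{i=1}^t f(u_i) over all integer sequences (u_1, …, u_t) with 0 ≤ u_i ≤ m for all i and Σ_{i=1}^t u_i = tm − r equals r_1·(q^m − 1)/N + f(r_2). -/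
/-- The function `f` from Lemma 2:
`f(l) = q^l - 1` for `0 ≤ l ≤ m/2` and
`f(l) = (q^l - 1)/N + (N-1)(q^{m/2} - q^{l-m/2})/N` for `m/2 ≤ l ≤ m`. -/
noncomputable def ghwf (q N m l : ℕ) : ℚ :=
  if 2 * l ≤ m then (q : ℚ) ^ l - 1
  else ((q : ℚ) ^ l - 1) / N +
    ((N : ℚ) - 1) * ((q : ℚ) ^ (m / 2) - (q : ℚ) ^ (l - m / 2)) / N

lemma ghwf_of_le {q N m l h : ℕ} (hh : m = h + h) (hl : l ≤ h) :
    ghwf q N m l = (q : ℚ) ^ l - 1 := by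
  rw [ghwf, if_pos (by omega)]

lemma ghwf_half_add {q N m h : ℕ} {c : ℚ} (hh : m = h + h) (hN : (N : ℚ) ≠ 0)
    (hc : N * c = (q : ℚ) ^ h + 1 - N) (j : ℕ) :
    ghwf q N m (h + j) = (q : ℚ) ^ h - 1 + c * ((q : ℚ) ^ j - 1) := by
  rcases Nat.eq_zero_or_pos j with rfl | hj
  · rw [ghwf_of_le hh (by omega)]
    simp
  · have hm : m / 2 = h := by omega
    rw [ghwf, if_neg (by omega), hm, Nat.add_sub_cancel_left, pow_add]
    have hc' : c = ((q : ℚ) ^ h + 1 - N) / N := by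
      rw [← hc]; field_simp
    rw [hc']
    field_simp
    ring

lemma ghwf_zero (q N m : ℕ) : ghwf q N m 0 = 0 := by
  simp [ghwf]

lemma add_le_add_of_mul_eq {x y z Q : ℚ} (hQ : 0 < Q) (hx : x ≤ Q) (hy : y ≤ Q)
    (h : Q * z = x * y) : x + y ≤ Q + z := by
  have := mul_nonneg (sub_nonneg.2 hx) (sub_nonneg.2 hy)
  refine le_of_mul_le_mul_left ?_ hQ
  nlinarith

section Exchange

variable {q N m h : ℕ} {c : ℚ}

lemma ghwf_add_le (hq : 1 ≤ q) (hh : m = h + h) (hN : (N : ℚ) ≠ 0)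
    (hc : N * c = (q : ℚ) ^ h + 1 - N) (hc1 : 1 ≤ c) {a b : ℕ} (hab : a + b ≤ m) :
    ghwf q N m a + ghwf q N m b ≤ ghwf q N m (a + b) := by
  wlog hba : b ≤ a generalizing a b
  · rw [add_comm, add_comm a]
    exact this (by omega) (by omega)
  have hq' : (1 : ℚ) ≤ q := by exact_mod_cast hq
  have one_le (n : ℕ) : (1 : ℚ) ≤ (q : ℚ) ^ n := one_le_pow₀ hq'
  have hb := one_le b
  rw [ghwf_of_le hh (show b ≤ h by omega)]
  by_cases hah : a ≤ h
  · rw [ghwf_of_le hh hah]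
    have ha := one_le a
    by_cases hs : a + b ≤ h
    · rw [ghwf_of_le hh hs, pow_add]
      nlinarith [mul_nonneg (sub_nonneg.2 ha) (sub_nonneg.2 hb)]
    · obtain ⟨j, hj⟩ : ∃ j, a + b = h + j := ⟨a + b - h, by omega⟩
      rw [hj, ghwf_half_add hh hN hc]
      have hxy := add_le_add_of_mul_eq (zero_lt_one.trans_le (one_le h))
        (pow_le_pow_right₀ hq' hah) (pow_le_pow_right₀ hq' (show b ≤ h by omega))
        (show (q : ℚ) ^ h * (q : ℚ) ^ j = (q : ℚ) ^ a * (q : ℚ) ^ b by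
          rw [← pow_add, ← pow_add, hj])
      nlinarith [mul_nonneg (sub_nonneg.2 hc1) (sub_nonneg.2 (one_le j))]
  · obtain ⟨i, rfl⟩ : ∃ i, a = h + i := ⟨a - h, by omega⟩
    rw [add_assoc, ghwf_half_add hh hN hc, ghwf_half_add hh hN hc, pow_add]
    have hci : 1 ≤ c * (q : ℚ) ^ i := one_le_mul_of_one_le_of_one_le hc1 (one_le i)
    nlinarith [mul_nonneg (sub_nonneg.2 hci) (sub_nonneg.2 hb)]

lemma ghwf_add_le_of_eq_add (hq : 1 ≤ q) (hh : m = h + h) (hN : (N : ℚ) ≠ 0)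
    (hc : N * c = (q : ℚ) ^ h + 1 - N) (hc1 : 1 ≤ c) {a b s : ℕ} (ha : a ≤ m) (hb : b ≤ m)
    (hab : a + b = m + s) :
    ghwf q N m a + ghwf q N m b ≤ ghwf q N m m + ghwf q N m s := by
  wlog hba : b ≤ a generalizing a b
  · rw [add_comm]
    exact this hb ha (by omega) (by omega)
  have hq' : (1 : ℚ) ≤ q := by exact_mod_cast hq
  have one_le (n : ℕ) : (1 : ℚ) ≤ (q : ℚ) ^ n := one_le_pow₀ hq'
  have hQ : (0 : ℚ) < (q : ℚ) ^ h := zero_lt_one.trans_le (one_le h)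
  have hfm : ghwf q N m m = (q : ℚ) ^ h - 1 + c * ((q : ℚ) ^ h - 1) := by
    rw [← ghwf_half_add hh hN hc h, ← hh]
  obtain ⟨i, rfl⟩ : ∃ i, a = h + i := ⟨a - h, by omega⟩
  have hi : (q : ℚ) ^ i ≤ (q : ℚ) ^ h := pow_le_pow_right₀ hq' (by omega)
  rw [hfm, ghwf_half_add hh hN hc]
  by_cases hbh : b ≤ h
  · rw [ghwf_of_le hh hbh, ghwf_of_le hh (show s ≤ h by omega)]
    have hxy := add_le_add_of_mul_eq hQ hi (pow_le_pow_right₀ hq' hbh)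
      (show (q : ℚ) ^ h * (q : ℚ) ^ s = (q : ℚ) ^ i * (q : ℚ) ^ b by
        rw [← pow_add, ← pow_add]; congr 1; omega)
    nlinarith [mul_nonneg (sub_nonneg.2 hc1) (sub_nonneg.2 hi)]
  · obtain ⟨j, rfl⟩ : ∃ j, b = h + j := ⟨b - h, by omega⟩
    have hj : (q : ℚ) ^ j ≤ (q : ℚ) ^ h := pow_le_pow_right₀ hq' (by omega)
    rw [ghwf_half_add hh hN hc]
    by_cases hsh : s ≤ h
    · rw [ghwf_of_le hh hsh]
      have hs : (q : ℚ) ^ s = (q : ℚ) ^ i * (q : ℚ) ^ j := by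
        rw [← pow_add]; congr 1; omega
      have hsQ : (q : ℚ) ^ s ≤ (q : ℚ) ^ h := pow_le_pow_right₀ hq' hsh
      have hxy := mul_nonneg (sub_nonneg.2 (one_le i)) (sub_nonneg.2 (one_le j))
      have hgap : 0 ≤ (q : ℚ) ^ h - (q : ℚ) ^ i - (q : ℚ) ^ j + 1 := by nlinarith
      nlinarith [mul_nonneg (sub_nonneg.2 hc1) hgap]
    · obtain ⟨k, rfl⟩ : ∃ k, s = h + k := ⟨s - h, by omega⟩
      rw [ghwf_half_add hh hN hc]
      have hxy := add_le_add_of_mul_eq hQ hi hj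
        (show (q : ℚ) ^ h * (q : ℚ) ^ k = (q : ℚ) ^ i * (q : ℚ) ^ j by
          rw [← pow_add, ← pow_add]; congr 1; omega)
      nlinarith [mul_le_mul_of_nonneg_left hxy (zero_le_one.trans hc1)]

end Exchange

/-- If `f` satisfies the two exchange inequalities, sums of values of `f` on `[0, m]` are largest
when all but one of the arguments are `0` or `m`. -/
lemma sum_le_div_mul_add_mod {ι : Type*} {f : ℕ → ℚ} {m : ℕ} (hm : 0 < m) (h0 : f 0 = 0)
    (hlow : ∀ a b, a + b ≤ m → f a + f b ≤ f (a + b))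
    (hhigh : ∀ a b s, a ≤ m → b ≤ m → a + b = m + s → f a + f b ≤ f m + f s)
    (S : Finset ι) (u : ι → ℕ) (hu : ∀ i, u i ≤ m) :
    ∑ i ∈ S, f (u i) ≤ ((∑ i ∈ S, u i) / m : ℕ) * f m + f ((∑ i ∈ S, u i) % m) := by
  classical
  induction S using Finset.induction_on with
  | empty => simp [h0]
  | insert i S hi ih =>
    rw [Finset.sum_insert hi, Finset.sum_insert hi]
    set n := ∑ i ∈ S, u i
    have hr : n % m < m := Nat.mod_lt _ hm
    have hn := Nat.div_add_mod n m
    by_cases hlt : u i + n % m < m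
    · have hdm : (u i + n) / m = n / m ∧ (u i + n) % m = u i + n % m :=
        (Nat.div_mod_unique hm).2 ⟨by omega, hlt⟩
      rw [hdm.1, hdm.2]
      linarith [hlow (u i) (n % m) hlt.le]
    · obtain ⟨s, hs⟩ : ∃ s, u i + n % m = m + s := ⟨u i + n % m - m, by omega⟩
      have hui := hu i
      have hdm : (u i + n) / m = n / m + 1 ∧ (u i + n) % m = s :=
        (Nat.div_mod_unique hm).2 ⟨by rw [mul_add]; omega, by omega⟩
      rw [hdm.1, hdm.2]
      push_cast
      linarith [hhigh (u i) (n % m) s hui hr.le hs]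

lemma sum_apply_ite_lt_ite_eq {M : Type*} [AddCommMonoid M] (g : ℕ → M) (h0 : g 0 = 0)
    {t k : ℕ} (hk : k < t) (a b : ℕ) :
    ∑ i : Fin t, g (if (i : ℕ) < k then a else if (i : ℕ) = k then b else 0) =
      k • g a + g b := by
  rw [Fin.sum_univ_eq_sum_range
    (fun i => g (if i < k then a else if i = k then b else 0)) t]
  obtain ⟨d, rfl⟩ : ∃ d, t = k + 1 + d := ⟨t - (k + 1), by omega⟩
  rw [Finset.sum_range_add, Finset.sum_range_succ]
  have hhead : ∑ i ∈ Finset.range k, g (if i < k then a else if i = k then b else 0) =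
      k • g a := by
    rw [Finset.sum_congr rfl fun i hi => by rw [if_pos (Finset.mem_range.1 hi)]]
    simp
  have htail : ∑ i ∈ Finset.range d,
      g (if k + 1 + i < k then a else if k + 1 + i = k then b else 0) = 0 :=
    Finset.sum_eq_zero fun i _ => by
      rw [if_neg (by omega), if_neg (by omega), h0]
  rw [hhead, htail]
  simp

theorem stmt14 (q m N t r r1 r2 : ℕ) (hq : 2 ≤ q) (hmeven : Even m) (hm : 2 ≤ m)
    (hN : 2 < N) (hNle : 2 * N ≤ q ^ (m / 2) + 1)
    (hsemi : (q : ZMod N) ^ (m / 2) = -1)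
    (ht : 1 ≤ t) (hr1 : 1 ≤ r) (hr2 : r ≤ t * m)
    (hdecomp : t * m - r = r1 * m + r2) (hr1' : r1 ≤ t - 1) (hr2' : r2 ≤ m - 1) :
    IsGreatest
      {x : ℚ | ∃ u : Fin t → ℕ, (∀ i, u i ≤ m) ∧ (∑ i, u i) = t * m - r ∧
        x = ∑ i, ghwf q N m (u i)}
      ((r1 : ℚ) * ((q : ℚ) ^ m - 1) / N + ghwf q N m r2) := by
  obtain ⟨h, hh⟩ := hmeven
  have hm2 : m / 2 = h := by omega
  rw [hm2] at hNle
  have hN0 : (0 : ℚ) < N := by exact_mod_cast (by omega : 0 < N)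
  have hNle' : 2 * (N : ℚ) ≤ (q : ℚ) ^ h + 1 := by exact_mod_cast hNle
  obtain ⟨c, hc⟩ : ∃ c : ℚ, N * c = (q : ℚ) ^ h + 1 - N :=
    ⟨((q : ℚ) ^ h + 1 - N) / N, mul_div_cancel₀ _ hN0.ne'⟩
  have hc1 : 1 ≤ c := le_of_mul_le_mul_left (by linarith) hN0
  have hfm : ghwf q N m m = ((q : ℚ) ^ m - 1) / N := by
    rw [ghwf, if_neg (by omega), hm2, show m - h = h by omega]
    simp
  rw [mul_div_assoc, ← hfm]
  constructor
  · refine ⟨fun i => if (i : ℕ) < r1 then m else if (i : ℕ) = r1 then r2 else 0, ?_, ?_, ?_⟩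
    · intro i
      dsimp only
      split_ifs <;> omega
    · have := sum_apply_ite_lt_ite_eq (fun n => n) rfl (show r1 < t by omega) m r2
      rw [hdecomp, this, smul_eq_mul]
    · rw [sum_apply_ite_lt_ite_eq (ghwf q N m) (ghwf_zero q N m) (show r1 < t by omega),
        nsmul_eq_mul]
  · rintro x ⟨u, hu, hsum, rfl⟩
    have key := sum_le_div_mul_add_mod (f := ghwf q N m) (by omega) (ghwf_zero q N m)
      (fun a b => ghwf_add_le (by omega) hh hN0.ne' hc hc1)
      (fun a b s => ghwf_add_le_of_eq_add (by omega) hh hN0.ne' hc hc1)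
      Finset.univ u hu
    have hdm : (r1 * m + r2) / m = r1 ∧ (r1 * m + r2) % m = r2 :=
      (Nat.div_mod_unique (by omega)).2 ⟨by rw [mul_comm, add_comm], by omega⟩
    rwa [hsum, hdecomp, hdm.1, hdm.2] at key
end
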